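/- The multiset {3,3,3,1} is not representable: there is no 4-blocked point set in the plane whose four colour classes have sizes 3, 3, 3 and 1. -/

import Mathlib

/-- `x` blocks `v` and `w` if `x` lies strictly between `v` and `w`. -/
def Blocks {E : Type*} [AddCommGroup E] [Module ℝ E] (x v w : E) : Prop :=
  x ∈ openSegment ℝ v w

/-- `v` and `w` are visible with respect to `P` if no point of `P` blocks them. -/
def Visible {E : Type*} [AddCommGroup E] [Module ℝ E] (P : Set E) (v w : E) : Prop :=
  ∀ x ∈ P, ¬ Blocks x v w

/-- `c` is a blocked colouring of `P`: distinct points of `P` are visible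
iff they get different colours. -/
def BlockedColouring {E : Type*} [AddCommGroup E] [Module ℝ E] {k : ℕ}
    (P : Set E) (c : E → Fin k) : Prop :=
  ∀ v ∈ P, ∀ w ∈ P, v ≠ w → (Visible P v w ↔ c v ≠ c w)

/-- `P` is `k`-blocked. -/
def KBlocked {E : Type*} [AddCommGroup E] [Module ℝ E] (k : ℕ) (P : Set E) : Prop :=
  P.Finite ∧ ∃ c : E → Fin k, BlockedColouring P c

/-- `P` is `{n₁,…,n_k}`-blocked where `N` is the multiset of colour class sizes. -/
def IsNBlocked {E : Type*} [AddCommGroup E] [Module ℝ E] (N : Multiset ℕ) (P : Set E) : Prop :=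
  P.Finite ∧ ∃ (k : ℕ) (c : E → Fin k), BlockedColouring P c ∧
    N = Finset.univ.val.map (fun i : Fin k => (P ∩ c ⁻¹' {i}).ncard)

/-- A multiset of positive integers is representable if some planar point set is
`N`-blocked. -/
def Representable (N : Multiset ℕ) : Prop :=
  ∃ P : Set (ℝ × ℝ), IsNBlocked N P

/-- A set is in convex position if no point lies in the convex hull of the others. -/
def ConvexPosition {E : Type*} [AddCommGroup E] [Module ℝ E] (K : Set E) : Prop :=
  ∀ x ∈ K, x ∉ convexHull ℝ (K \ {x})

/-- `P` is `N`-midpoint-blocked: `N`-blocked, and midpoints of monochromatic pairs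
belong to `P`. -/
def IsNMidpointBlocked {E : Type*} [AddCommGroup E] [Module ℝ E]
    (N : Multiset ℕ) (P : Set E) : Prop :=
  P.Finite ∧ ∃ (k : ℕ) (c : E → Fin k), BlockedColouring P c ∧
    (∀ v ∈ P, ∀ w ∈ P, v ≠ w → c v = c w → midpoint ℝ v w ∈ P) ∧
    N = Finset.univ.val.map (fun i : Fin k => (P ∩ c ⁻¹' {i}).ncard)

/-- A refutation tree: each node propagates the constraints with the given codes in order, and
an inner node then branches on a literal. -/
inductive Refutation
  | leaf (steps : List ℕ)
  | split (steps : List ℕ) (l : ℕ) (pos neg : Refutation)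

/-- The opposite of a literal. -/
def negLit (l : ℕ) : ℕ := if l % 2 = 0 then l + 1 else l - 1

/-- The literal stating that the ordered triple `a b c` is positively oriented. -/
def orientLit (a b c : ℕ) : ℕ :=
  if a < b then
    if b < c then 4 * (100 * a + 10 * b + c)
    else if a < c then 4 * (100 * a + 10 * c + b) + 1
    else 4 * (100 * c + 10 * a + b)
  else
    if a < c then 4 * (100 * b + 10 * a + c) + 1
    else if b < c then 4 * (100 * b + 10 * c + a)
    else 4 * (100 * c + 10 * b + a) + 1

/-- The literal stating that the triple `a b c` is collinear. -/
def collLit (a b c : ℕ) : ℕ := orientLit a b c / 4 * 4 + 2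

/-- The literal stating that the triple `a b c` is not collinear. -/
def ncollLit (a b c : ℕ) : ℕ := orientLit a b c / 4 * 4 + 3

/-- The literal `l` or its opposite. -/
def signLit (s : Bool) (l : ℕ) : ℕ := if s then l else negLit l

/-- Exactly two of the three points share their colour. -/
def TwoOne (a b c : ℕ) : Prop :=
  a / 3 = b / 3 ∧ c / 3 ≠ a / 3 ∨ a / 3 = c / 3 ∧ b / 3 ≠ a / 3 ∨ b / 3 = c / 3 ∧ a / 3 ≠ b / 3

instance (a b c : ℕ) : Decidable (TwoOne a b c) := by unfold TwoOne; infer_instance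

/-- The literal excluding collinearity of a triple, where it is not automatic. -/
def ncollLits (a b c : ℕ) : List ℕ := if TwoOne a b c then [ncollLit a b c] else []

/-- Sign patterns violating the Grassmann–Plücker relation. -/
def gpNogood (v a b c d e : ℕ) : List ℕ :=
  if [a, b, c, d, e].Nodup then
    [signLit (v % 2 == 0) (orientLit a b c),
      signLit ((v % 2 == 0) == (v / 8 == 0)) (orientLit a d e),
      signLit (v / 2 % 2 == 0) (orientLit a b d),
      signLit ((v / 2 % 2 == 0) != (v / 8 == 0)) (orientLit a c e),
      signLit (v / 4 % 2 == 0) (orientLit a b e),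
      signLit ((v / 4 % 2 == 0) == (v / 8 == 0)) (orientLit a c d)] ++
    (ncollLits a b c ++ ncollLits a d e ++ ncollLits a b d ++ ncollLits a c e ++ ncollLits a b e ++
      ncollLits a c d)
  else [0, 1]

/-- The orientation of the point `d` with respect to `a c`, `a b` or `c b`. -/
def sideLit (n a b c d : ℕ) : ℕ :=
  if n = 0 then orientLit a c d else if n = 1 then orientLit a b d else orientLit c b d

/-- If `c` blocks `a` and `b`, then every other point `d` sees `a c`, `a b`, `c b` with the same
orientation. -/
def sideNogood (v a b c d : ℕ) : List ℕ :=
  if [a, b, c, d].Nodup ∧ a / 3 = b / 3 ∧ c / 3 ≠ a / 3 then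
    [collLit a b c, sideLit (v / 3) a b c d, negLit (sideLit (v % 3) a b c d)]
  else [0, 1]

/-- No four points are collinear. -/
def crossNogood (a b c d : ℕ) : List ℕ :=
  if [a, b, c, d].Nodup then [collLit a b c, collLit a b d] else [0, 1]

/-- Two points of the same colour are blocked. -/
def edgeNogood (a b : ℕ) : List ℕ :=
  if a ≠ b ∧ a / 3 = b / 3 then
    ((List.range 10).filter fun k => k / 3 ≠ a / 3).map (ncollLit a b)
  else [0, 1]

/-- The constraint with a given code: five digits for the points, preceded by the kind. -/
def nogood (hyps : List (List ℕ)) (s : ℕ) : List ℕ :=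
  let v := s / 100000
  let a := s / 10000 % 10
  let b := s / 1000 % 10
  let c := s / 100 % 10
  let d := s / 10 % 10
  let e := s % 10
  if v < 16 then gpNogood v a b c d e
  else if v < 25 then sideNogood (v - 16) a b c d
  else if v = 25 then crossNogood a b c d
  else if v = 26 then edgeNogood a b
  else hyps.getD (v - 27) [0, 1]

/-- Unit propagation, on a bit mask of the literals known to hold. -/
def propagate (hyps : List (List ℕ)) : List ℕ → (ℕ → Bool) → ℕ → Bool
  | [], k, M => k M
  | s :: ss, k, M =>
    match (nogood hyps s).filter fun l => !M.testBit l with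
    | [] => true
    | [l] => propagate hyps ss k (M ||| 2 ^ negLit l)
    | _ => false

/-- Does the tree refute the constraints, given a mask of known literals? -/
def Refutation.check (hyps : List (List ℕ)) : Refutation → ℕ → Bool
  | .leaf ss => propagate hyps ss fun _ => false
  | .split ss l p n => propagate hyps ss fun M =>
      p.check hyps (M ||| 2 ^ l) && n.check hyps (M ||| 2 ^ negLit l)

/-- The points seen as blockers of the edges of each colour class have three distinct colours,
cyclically arranged. -/
def rainbowHyps : List (List ℕ) :=
  [[negLit (orientLit 0 1 2)], [ncollLit 1 2 9], [ncollLit 4 5 9], [ncollLit 7 8 9],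
    [3, 4, 5].map (ncollLit 0 1), [6, 7, 8].map (ncollLit 0 2),
    [6, 7, 8].map (ncollLit 3 4), [0, 1, 2].map (ncollLit 3 5),
    [0, 1, 2].map (ncollLit 6 7), [3, 4, 5].map (ncollLit 6 8)]

/-- Two edges with a common end `0` of one class are blocked by the points `3` and `4` of another
class, up to relabelling. -/
def pairHyps : List (List ℕ) :=
  [[negLit (orientLit 0 1 2)], [ncollLit 0 1 3], [ncollLit 0 2 4],
    [0, 1, 2, 6, 9].map (ncollLit 3 4)]

/-- A refutation of `rainbowHyps`. -/
def rainbowCert : Refutation :=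
  (.split [2700000, 2800000, 2900000, 3000000, 1912900, 2112900, 2529010, 2512790, 2519020,
    2512490, 2512390, 2512590, 2545290, 2545090, 2545890, 2559340, 2549350, 2578490, 2589670,
    2579680, 2578090, 2578290, 2578590, 2578190, 2578390] 66
  (.leaf [2501460, 2501560, 2501360, 3100000])
  (.split [] 70
  (.leaf [2501470, 2501370, 2501570, 3100000])
  (.split [] 74
  (.leaf [2501380, 2501580, 2501480, 3100000])
  (.split [] 94
  (.leaf [2502370, 2502360, 2502380, 3200000])
  (.split [] 98
  (.leaf [2502460, 2502480, 2502470, 3200000])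
  (.split [] 102
  (.leaf [2502580, 2502560, 2502570, 3200000])
  (.split [] 1426
  (.leaf [2535060, 2535160, 2535260, 3400000])
  (.split [] 1430
  (.leaf [2535070, 2535270, 2535170, 3400000])
  (.split [] 1434
  (.leaf [2535180, 2535280, 2535080, 3400000])
  (.split [] 274
  (.leaf [2568050, 2568040, 2568030, 3600000])
  (.split [] 674
  (.leaf [2568130, 2568140, 2568150, 3600000])
  (.split [] 1074
  (.leaf [2568240, 2568250, 2568230, 3600000])
  (.split [] 496
  (.split [2112940, 1912940, 1845920, 1945910, 2245910, 2112950, 2101590] 492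
  (.split [2112930, 1912930] 180
  (.split [1945900, 2145900] 106
  (.leaf [2302690, 1702690, 2506270, 2526070, 790256, 1390246, 2212960, 3500000, 1767190, 1867190,
    291567, 1191467, 1878960, 1778960, 2278950, 1778940, 1768490, 2368590, 3600000, 2536480,
    2368370, 2538460, 3300000, 1834780])
  (.split [] 110
  (.leaf [2507260, 2527060, 2302710, 1702790, 2302790, 3500000, 1912970, 1867120, 1490157,
    1390247, 1878920, 1867190, 1967190, 591467, 1291567, 2312960, 1878950, 2278940, 2278960,
    2268490, 1868590, 3600000, 2168390, 1968390, 692368])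
  (.split [2602000, 2302890, 1802890, 1878920, 2212980, 790258, 1390248, 2378900, 2278900, 190247,
    2378910, 2178950, 2345980, 2378940] 1512
  (.leaf [2234870, 1834780, 3300000, 2536480, 2546380, 3600000, 2368570, 2368540, 1834680, 383467,
    2134680])
  (.split [1778930, 492347, 1934790] 2712
  (.leaf [2368570, 2368370, 2668000, 2548360, 2546380, 3300000])
  (.leaf [2367080, 2367180, 2168470, 1778960, 3500000, 1767290, 190267, 790256, 2268590, 2668000,
    2536480, 2538460, 3300000])))))
  (.leaf [2345900, 2201450, 2601000, 2513050, 2201390, 2201320, 2503150, 2635000, 1835200,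
    1735200, 1302359]))
  (.leaf [2101320, 1835210, 2235120, 2601000, 3400000, 2301450, 1835010, 1935010, 510235]))
  (.split [1712940, 2312940, 2101420, 1745910, 1845910, 1945920, 2245920, 1712950] 54
  (.leaf [2513050, 2101320, 2503150, 2635000, 2235210])
  (.split [2601000, 1901590, 2505130, 2201540, 1701540, 2515030, 1901520, 1845900, 3400000,
    2135200, 1835200, 2235240, 2235210, 1735240, 2235290, 1701530, 602359, 1712930, 1745930] 106
  (.leaf [2302690, 1702690, 2506270, 2102630, 2526070, 790246, 790236, 2212960, 3500000, 1734620,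
    1767190, 1867190, 291367, 1393467, 1978930, 2234790, 1978940, 1834870, 3300000])
  (.split [] 512
  (.leaf [1912980, 2112980, 2378910, 1878920, 2178920, 2302790, 2602000, 1802810, 1802890,
    1702850, 2302850, 2102830, 1802870, 2101580, 790248, 880157, 750248, 2135280, 682357, 1734820,
    2178940, 2234780, 3300000, 2334650, 2536480, 2546380, 1868540, 3600000])
  (.leaf [1712980, 2312980, 2302810, 1878910, 2378920, 2278920, 3200000, 1712970, 1802780,
    1802790, 790237, 2507260, 1802710, 2527060, 710237, 710247, 2378900, 1878930, 1734790,
    3500000, 1867130, 1867140, 1190348, 2234890, 3300000, 2234610])))))))))))))))))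

/-- A refutation of `pairHyps`. -/
def pairCert : Refutation :=
  (.split [2700000, 2800000, 2900000, 1901320, 2101320, 1702410, 2302410, 2501340, 2501350,
    2501360, 2501370, 2501380, 2501390, 2503120, 2513020, 2503140, 2513040, 2503150, 2513050,
    1901340, 2101340, 2502450, 2502460, 2502470, 2502480, 2502490, 2524010, 2524030, 2504250,
    2524050, 2202430] 1390
  (.leaf [2534670, 2534790, 3000000])
  (.split [] 1394
  (.leaf [2534680, 2534890, 3000000])
  (.split [] 1386
  (.split [2534690, 2536450, 2546350, 2536470, 2546370, 2536480, 2546380, 1934600, 2134600,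
    1734610, 2234610, 1734620, 2234620, 1701360, 1902460, 1812630, 412346] 510
  (.split [2517260, 2527160, 2517280, 2527180, 1912700, 2112700, 1912730, 2112730, 1912740,
    1912760, 2112760, 1061237, 61247, 1571346, 1901370, 1867010, 1702470] 1380
  (.leaf [1934650, 2134650, 1735240, 1735740, 1945130, 1945730, 1767530, 2667000, 1767930,
    1967940, 1735960, 1945960, 2635000, 2645000, 2558340])
  (.split [1734650, 2334650] 140
  (.split [1701350, 1801350, 2245100] 180
  (.leaf [1945700, 1456, 1457, 440135, 240157, 1867500, 2667000, 2579680, 2167940, 1745970,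
    2645000, 2548570, 2558470, 1945800, 1745830, 1745870, 2178040, 2278340, 2678000])
  (.split [1902450, 2202450, 1835200] 1396
  (.leaf [1934690, 1935940, 1745930, 1767930, 2667000, 2557360, 2557460, 2267530, 1867540,
    2635000, 2645000, 2335870, 2145870])
  (.split [1734690, 2334690] 1516
  (.split [] 1916
  (.leaf [1867940, 1573469, 2667000, 1967590, 2167590, 2557360, 2557460, 2267530, 1867540,
    1835960, 2245970, 2635000, 2645000, 2335870, 2145870])
  (.split [] 2316
  (.leaf [1835790, 2235970, 2635000, 2558340, 2558360, 2538570, 2558370, 1935800, 1735810,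
    1935840, 2135840, 342358, 1868030, 1878030, 2268130, 1878430, 1868240, 2668000, 2678000,
    2589670])
  (.leaf [2245790, 1845970, 2645000, 2558340, 2558460, 2548570, 2558470, 1745800, 1945820,
    1745830, 2245830, 431458, 2268040, 2278040, 1868240, 2278340, 2268130, 2668000, 2678000,
    2589670])))
  (.leaf [2267930, 2667000, 2557360, 2557460, 2267530, 1735970, 734579, 2635000, 2245930, 2558340,
    2645000]))))
  (.leaf [1735200, 1735700, 330245, 530257, 2267530, 2667000, 2579680, 1767930, 2267930, 1935970,
    2635000, 2538570, 2558370, 1735800, 1935840, 1935870, 2378030, 1878430, 2678000])))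
  (.split [] 514
  (.split [2518260, 2528160, 2518270, 2528170, 1912800, 2112800, 1912830, 2112830, 1912840,
    1912860, 2112860, 1061238, 61248, 1581346, 1901380, 1868010, 1702480] 1380
  (.leaf [1934650, 2134650, 1735240, 1735840, 1945130, 1945830, 1768530, 2668000, 1768930,
    1968940, 1735960, 1945960, 2635000, 2645000, 2557340])
  (.split [1734650, 2334650] 140
  (.split [1701350, 1801350, 2245100] 180
  (.leaf [1945800, 1456, 1458, 440135, 240158, 1868500, 2668000, 2589670, 2168940, 1745980,
    2645000, 2547580, 2557480, 1945700, 1745730, 1745780, 1778040, 2278340, 2678000])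
  (.split [1902450, 2202450, 1835200] 1396
  (.leaf [1934690, 1935940, 1745930, 1768930, 2668000, 2558360, 2558460, 2268530, 1868540,
    2635000, 2645000, 2335780, 2145780])
  (.split [1734690, 2334690] 1556
  (.split [] 1956
  (.leaf [1868940, 1583469, 2668000, 1968590, 2168590, 2558360, 2558460, 2268530, 1868540,
    1835960, 2245980, 2635000, 2645000, 2335780, 2145780])
  (.split [] 2356
  (.leaf [1835890, 2235980, 2635000, 2557340, 2557360, 2537580, 2557380, 1935700, 1735710,
    1935740, 2135740, 342357, 1867030, 1878030, 2267130, 1878430, 1867240, 2667000, 2678000,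
    2579680])
  (.leaf [2245890, 1845980, 2645000, 2557340, 2557460, 2547580, 2557480, 1745700, 1945720,
    1745730, 2245730, 431457, 2267040, 2278040, 1867240, 2278340, 2267130, 2667000, 2678000,
    2579680])))
  (.leaf [2268930, 2668000, 2558360, 2558460, 2268530, 1735980, 734589, 2635000, 2245930, 2557340,
    2645000]))))
  (.leaf [1735200, 1735800, 330245, 530258, 2268530, 2668000, 2589670, 1768930, 2268930, 1935980,
    2635000, 2537580, 2557380, 1735700, 1935740, 1935780, 1978030, 1878430, 2678000])))
  (.split [] 502
  (.split [2525130, 2515240, 1912500, 2112500, 1912530, 2112530, 1912540, 2112540, 1912560,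
    2112560, 31245, 831256, 441256, 1901350, 1702450] 1430
  (.leaf [2557340, 2557360, 1935700, 1735710, 2135720, 1935740, 2135760, 1867030, 2267130,
    2267250, 2334670, 2667000, 1967940, 2569780, 1967950, 2245960, 2645000, 2558460, 1745800,
    1745810, 2245810, 1945820, 2268040, 1868150, 1868240, 2668000])
  (.split [] 1434
  (.leaf [2558340, 2558360, 1935800, 1735810, 2135820, 1935840, 2135860, 1868030, 2268130,
    2268250, 2334680, 2668000, 1968940, 2569780, 1968950, 2245960, 2645000, 2557460, 1745700,
    1745710, 2245710, 1945720, 2267040, 1867150, 1867240, 2667000])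
  (.split [2635000, 2559340, 2135960] 1830
  (.leaf [2557460, 1745700, 1745710, 2245710, 1945720, 1745760, 2245760, 2267040, 1867150,
    1867240, 1767950, 2667000])
  (.leaf [2645000, 2558460, 1745800, 1745810, 2245810, 1945820, 1745860, 2245860, 2268040,
    1868150, 1868240, 1768950, 2668000]))))
  (.split [2612000, 1912900, 2112900, 1912930, 2112930, 1912940, 2112940, 1912960, 2112960,
    1901390, 1702490, 1390234, 31269, 840169] 942
  (.split [2535290, 1735200, 1835200, 1935210, 2235210, 1735240, 1835240, 1735260, 1835260,
    1935290, 2235290, 1092356, 1701350, 1302356, 850136, 1902450, 2245130, 412345, 2334650,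
    2345930] 1830
  (.leaf [2557460, 1945700, 1745710, 2245710, 1745720, 2245720, 1745760, 2245760, 2167040,
    1867150, 1867250, 1767950, 2667000])
  (.leaf [2645000, 2558460, 1945800, 1745810, 2245810, 1745820, 2245820, 1745860, 2245860,
    2168040, 1868150, 1868250, 1768950, 2668000]))
  (.split [] 2314
  (.leaf [2557380, 2558370, 2557480, 2558470, 2635000, 2559340, 1935910, 2645000, 2245130])
  (.split [] 1514
  (.split [2537580, 2538570, 2635000, 2559340, 1935910, 2235910, 1735940, 1735960, 1835960,
    2245130, 1513459, 713569] 1912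
  (.leaf [1978340, 2178340, 1934670, 1745730, 1734680, 2334680, 1967130, 1967230, 1967530,
    1967930, 1778360, 2645000, 1768030, 2245860, 2667000, 1967080, 2558460, 1768150, 1768950,
    1768200, 2668000])
  (.leaf [1778340, 2378340, 1734670, 2334670, 1934680, 1745830, 1767030, 1978360, 1968130,
    1968230, 1968530, 1968930, 2645000, 2668000, 2557460, 1745710, 2245710, 2245760, 1968020,
    1867150, 1767950, 1767280, 2667000]))
  (.split [] 582
  (.split [2545190, 1945100, 2245100, 1745120, 1845120, 1945130, 2245130, 1945160, 2245160,
    1745190, 1845190, 1391456, 1902450, 1001456, 1550246, 1701350, 750123, 1734650, 2135940] 1430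
  (.leaf [2557360, 1735700, 2135710, 2135720, 1935760, 2135760, 2367030, 2267150, 2267250,
    1967950, 2667000])
  (.leaf [2635000, 2558360, 1735800, 2135810, 2135820, 1935860, 2135860, 2368030, 2268150,
    2268250, 1968950, 2668000]))
  (.split [] 1914
  (.split [2547580, 2548570, 2645000, 2559340, 2245910, 1745920, 1945930, 2245930, 2245960,
    432459, 1912950, 1321456, 1734650] 1512
  (.leaf [1978430, 2178430, 1734670, 2334670, 1934680, 1935840, 1767030, 1778460, 1968130,
    1968230, 1968530, 1968930, 2635000, 2668000, 2557360, 2135720, 1835760, 1768010, 2267250,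
    1967950, 1967180, 2667000])
  (.leaf [1778430, 2378430, 1934670, 2134670, 1935740, 1734680, 1967130, 1967230, 1967530,
    1967930, 1978460, 2635000, 1835860, 1768030, 2667000, 1767080, 2558360, 1968250, 1968950,
    2668000, 1968100]))
  (.split [] 670
  (.split [2516780, 2517680, 1967100, 2267100, 1767120, 1867120, 1767140, 1767190, 1867190,
    1701370] 672
  (.leaf [1967180, 1968210, 1968910, 1778260, 1778960, 2678000, 2508670, 2278030, 2278060,
    2668000, 460138, 1968500, 2168500, 903568, 2558360, 1968530, 1935700, 2635000, 1735960])
  (.split [1767180, 1768010, 1978060] 512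
  (.leaf [1912980, 2268210, 2268910, 2668000, 2558460, 1768510, 2268510, 1768570, 1015689,
    2245760, 2245910, 2645000])
  (.leaf [1712980, 1878210, 1878910, 2678000])))
  (.split [] 1074
  (.split [2526780, 2528670, 1768200, 1868200, 1968210, 2268210, 1968230, 1968290, 1902480,
    1712980] 1068
  (.split [1967020, 1968270, 2268270, 2178060] 508
  (.leaf [1912970, 2112970, 2267910, 2667000, 2557360, 1967520, 2167520, 1967580, 1325679,
    1835860, 1835920, 2635000])
  (.leaf [1712970, 1978120, 1878910, 2678000]))
  (.leaf [1767920, 1768270, 2378160, 2378960, 2678000, 2507680, 1878040, 1778060, 2667000, 360247,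
    1767500, 2367500, 1404567, 2557460, 1767540, 1745800, 2645000, 1945960]))
  (.split [] 1070
  (.split [2527680, 1767200, 1867200, 1967210, 2267210, 1967230, 1967290, 1902470, 1712970] 512
  (.split [1912980, 2112980, 1868120, 2268910] 1072
  (.leaf [1967280, 1968020, 2668000, 2558360, 1968520, 2168520, 1968570, 1325689, 1835760,
    1835920, 2635000])
  (.leaf [1767280, 1978160, 1978960, 2678000, 2508670, 1878040, 1878060, 2668000, 360248, 1768500,
    2368500, 1404568, 2558460, 1768540, 1745700, 2645000, 1945960]))
  (.leaf [1712980, 2278120, 1878910, 2678000, 1778020, 1878020, 220178]))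
  (.split [] 674
  (.split [2518670, 1968100, 2268100, 1768120, 1768140, 1768190, 1701380] 668
  (.leaf [1967910, 1968170, 2178260, 2178960, 2678000, 2507680, 2278030, 1978060, 2667000, 460137,
    1967500, 2167500, 903567, 2557360, 1967530, 1935800, 2635000, 1735960])
  (.split [1767010, 1768170, 1868170, 2378060] 508
  (.leaf [1912970, 2267910, 2667000, 2557460, 1767510, 2267510, 1767580, 1015679, 2245860,
    2245910, 2645000])
  (.leaf [1712970, 1778210, 1778910, 2678000])))
  (.split [] 1438
  (.split [2559340, 1735940, 1835960, 2334650] 1830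
  (.leaf [2557460, 1745760, 2245760, 1967040, 1767950, 2667000])
  (.leaf [2645000, 2558460, 1745860, 2245860, 1968040, 1768950, 2668000]))
  (.split [] 2270
  (.leaf [2557360, 2557460, 2556780, 2635000, 2558340, 2645000, 1945900, 1945930, 2245930,
    2245960, 1935840, 2135840, 1240358, 2135890, 2268950, 2268040, 2668000])
  (.split [] 2274
  (.leaf [2558360, 2558460, 2635000, 2557340, 2645000, 1945900, 1945930, 2245930, 2245960,
    1935740, 2135740, 1240357, 2135790, 2267950, 2267040, 2667000])
  (.split [] 270
  (.split [2506780, 1767030, 2668000, 1734670, 1968930, 1868940, 1934680] 1380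
  (.leaf [1735840, 1945830, 1945930, 2635000, 2645000, 2557340])
  (.leaf [1935740, 1745730, 2635000, 2558340, 1835840, 2645000, 1745980]))
  (.split [2667000, 2569780, 1967930, 1867940, 2668000, 1934670, 1768030, 1734680] 1380
  (.leaf [1735740, 1945730, 1945930, 2635000, 2645000, 2558340])
  (.leaf [1935840, 1745830, 2635000, 2557340, 1835740, 2645000, 1745970]))))))))))))))))))
  (.split [2634000, 2539450, 2549350, 1934900, 2134900, 1734910, 2234910, 1734920, 2234920,
    1701390, 1902490, 1812930, 412349] 506
  (.split [2512560, 2512670, 2512680, 2516270, 2526170, 2516280, 2526180, 1912600, 2112600,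
    1912630, 2112630, 1912640, 2112640, 1912690, 1901360, 1702460, 1360234, 831269, 40169] 668
  (.split [1712670, 1812670] 2270
  (.leaf [2556370, 2557360, 2556470, 2557460, 1967510, 1767520, 1845160, 2235260, 2645000,
    2635000, 2558340])
  (.split [] 1388
  (.split [1934970, 2134970] 942
  (.leaf [1735200, 1835200, 1935210, 2235210, 1735240, 1935260, 1735290, 1701350, 1302359, 850139,
    2245130, 412345, 1712650, 2345630, 1745730, 2645000, 1745810, 2345810, 1110458, 1113458,
    314589, 2268510, 2548560, 1868010, 1868310, 1868910, 2668000])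
  (.split [] 672
  (.split [1712680, 1878160, 2278210] 1426
  (.leaf [2556340, 2536580, 2556380, 1735600, 1935610, 2235610, 1735640, 1701350, 2245130,
    1513456, 713459, 1745730, 2645000, 1745810, 2345810, 1110458, 314589, 2548560, 1868010,
    1868910, 2668000])
  (.split [] 1430
  (.leaf [2557340, 2537560, 2537580, 2557380, 1935740, 2235740, 1945130, 1945630, 2645000,
    2548560, 2558460, 2548570, 2145830, 1945870, 1735780, 1778940, 2678000, 2507680, 2508670,
    1778030, 2278030, 1778040, 2268300, 1867400, 2668000, 2667000, 2569780])
  (.split [2635000, 2558340, 2538560, 2558360, 2538570, 2558370] 1392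
  (.leaf [1934980, 1935840, 2235840, 2278430, 2278930, 1945130, 1945630, 2678000, 2645000,
    2507680, 2508670, 2547560, 1845730, 1945780, 1735870, 2178040, 1978030, 1868400, 2267300,
    2668000, 2667000, 2569780])
  (.leaf [1734980, 1868430, 1868930, 2668000, 1868010, 1868030, 2268040, 2301380, 310248,
    380134]))))
  (.leaf [1768010, 1768310, 1768410, 1768910, 2668000, 2556380, 2558360, 2556480, 2558460,
    2635000, 2557340, 1935740, 2645000, 1945130])))
  (.leaf [1734970, 2267340, 1867430, 1867930, 2667000, 1867010, 1867030, 2267040, 2301370, 310247,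
    370134])))
  (.split [2212670, 1767010, 1767310, 1767410, 1767910, 2667000, 2556370, 2557360, 2556470,
    2557460, 2556780, 1767510, 2167520] 1428
  (.leaf [2267530, 1161345, 1745160, 2645000, 2548560, 1745860, 1968040, 1968340, 1968940,
    2668000])
  (.leaf [2335270, 1867530, 2635000, 1935860, 2538560, 1768030, 1768430, 1768930, 2668000])))
  (.split [] 714
  (.split [2517280, 2518270, 2517680, 2518670, 2612000, 2525130, 2515240, 2112500, 1912530,
    2112530, 2112540, 31245, 1702450] 1430
  (.leaf [2557340, 2537560, 2557360, 1735710, 2235710, 1935740, 2135740, 1240357, 1778150,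
    2334970, 2345870, 2645000, 2546570, 1745600, 1945620, 1745670, 2267040, 1767240, 2367940,
    2667000])
  (.split [] 1426
  (.split [2556340, 2536570, 2556370, 2536580, 2556380, 1935640, 2135640, 1240356, 342356,
    2334960] 1830
  (.leaf [2547560, 1745700, 1945720, 1745760, 2267040, 1867240, 1967940, 2667000])
  (.leaf [2645000, 2548560, 1745800, 1945820, 1745860, 2268040, 1868240, 1968940, 2668000]))
  (.leaf [2635000, 2558340, 2538560, 2558360, 1735810, 2235810, 1935840, 2135840, 1240358,
    2178150, 2334980, 2345780, 2645000, 2546580, 1745600, 1945620, 1745680, 2268040, 1768240,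
    2368940, 2668000])))
  (.split [] 1114
  (.split [2527180, 2528170, 2527680, 2528670, 2578250, 2612000, 2525130, 2515240, 1912500,
    2112500, 1912530, 2112530, 1912540, 2112540, 31245, 441259, 1901350, 1702450] 1430
  (.leaf [2557340, 2135700, 2135720, 1935740, 2135740, 342357, 1978250, 2278250, 150278, 1878240,
    2145820, 1550248, 2202480, 2645000, 1945680, 2168040, 2546580, 2556480, 1745610, 1745630,
    1745690, 1968140, 1968340, 1968940, 2668000])
  (.split [] 1426
  (.split [2556340, 2536570, 2556370, 2536580, 2556380, 1735610, 2235610, 1935640, 2135640,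
    1240356, 2334960] 1830
  (.leaf [2547560, 1745700, 1745710, 2245710, 1745760, 2267040, 1867150, 1967940, 2667000])
  (.leaf [2645000, 2548560, 1745800, 1745810, 2245810, 1745860, 2268040, 1868150, 1968940,
    2668000]))
  (.leaf [2635000, 2558340, 2135800, 2135820, 1935840, 2135840, 342358, 2278250, 2378250, 950278,
    1878240, 2145720, 1550247, 2202470, 2645000, 1945670, 2167040, 2546570, 2556470, 1745610,
    1745630, 1745690, 1967140, 1967340, 1967940, 2667000])))
  (.split [] 942
  (.split [2525130, 1735200, 1835200, 1935210, 2235210, 1835240, 1701350, 1902450, 2245130,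
    412345] 1830
  (.leaf [2547580, 2557480, 1945700, 2145700, 1745710, 2245710, 1745720, 1201457, 1812740, 710479,
    1113457, 2612000, 1912800, 1912830, 1912890, 1878010, 1878310, 1878910, 2678000])
  (.split [] 1826
  (.split [2546570, 2556470, 2546580, 2556480, 1945600, 2145600, 1745610, 2245610, 1201456,
    710469, 1113456] 510
  (.leaf [2517260, 2527160, 1912700, 1912730, 1912790, 1867010, 1867310, 1867910, 2667000])
  (.leaf [2612000, 2518260, 2528160, 1912800, 1912830, 1912890, 1868010, 1868310, 1868910,
    2668000]))
  (.leaf [2645000, 2548570, 2558470, 1945800, 2145800, 1745810, 2245810, 1745820, 1201458,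
    1812840, 710489, 1113458, 2612000, 1912700, 1912730, 1912790, 1878010, 1878310, 1878910,
    2678000])))
  (.split [] 2270
  (.leaf [2556370, 2557360, 2556470, 2557460, 2557680, 2635000, 2558340, 2538570, 2645000,
    2515240, 1945100, 1745120, 1845120, 1945130, 1121345, 1321459, 1902450, 1935840, 2135840,
    342358, 1935820, 2135820, 1220358, 423589, 1745180, 2212840, 2612000, 2112700, 2112740,
    2112790, 2278020, 2278420, 2278920, 2678000])
  (.split [] 2274
  (.leaf [2556380, 2558360, 2556480, 2558460, 2558670, 2635000, 2557340, 2537580, 2645000,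
    2515240, 1945100, 1745120, 1845120, 1945130, 1121345, 1321459, 1902450, 1935740, 2135740,
    342357, 1935720, 2135720, 1220357, 423579, 1745170, 2212740, 2612000, 2112800, 2112840,
    2112890, 2278020, 2278420, 2278920, 2678000])
  (.split [] 2314
  (.split [2557380, 2558370, 2557480, 2558470, 2635000, 2556340, 2536570, 2536580, 2645000,
    2515240, 1945100, 1745120, 1845120, 1945130, 1121345, 1321459, 1902450, 1935640, 2135640,
    342356, 1935620, 2135620, 1220356, 423569] 510
  (.leaf [2517260, 2527160, 2112700, 2112740, 2112790, 2267020, 2267420, 2267920, 2667000])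
  (.leaf [2612000, 2518260, 2528160, 2112800, 2112840, 2112890, 2268020, 2268420, 2268920,
    2668000]))
  (.split [] 582
  (.split [2515240, 1945100, 2245100, 1745120, 1845120, 1945130, 2245130, 1121345, 1902450,
    1701350] 1430
  (.leaf [2537580, 1735700, 2235700, 1935710, 1935720, 2135720, 1102357, 1912730, 20379, 123457,
    2612000, 2112800, 2112840, 2112890, 2278020, 2278420, 2278920, 2678000])
  (.split [] 510
  (.split [2517260, 2527160, 1912700, 2112700, 1912730, 2112730, 1912740, 2112740, 1712750,
    1901370, 1001257, 870135, 1702470, 1370234, 831279] 1384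
  (.leaf [1935640, 2635000, 2538570, 1735800, 1935840, 1935870, 2378030, 1878430, 1778930,
    2678000])
  (.leaf [1734960, 2267340, 1867430, 1867930, 2667000, 1867010, 1967010, 1867030, 2267040,
    2301360, 510467, 360134]))
  (.leaf [2612000, 2518260, 2528160, 1912800, 2112800, 1912830, 2112830, 2112840, 1901380,
    1702480, 1380234, 1935810, 1031258, 831289, 2635000, 1935680, 2168930, 2536580, 1735600,
    1968030, 2168430, 2668000])))
  (.split [] 510
  (.split [2512780, 2517260, 2527160, 1912700, 2112700, 1912730, 2112730, 1912740, 2112740,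
    1912790, 1901370, 1702470, 1370234, 831279] 504
  (.split [1912760] 712
  (.split [1712780, 1868170, 2268210] 1384
  (.split [1934960, 2134960] 1392
  (.split [1934980, 1868340, 2268430, 2268930, 2668000, 2506780, 2508670] 1380
  (.split [1735740, 1945730] 2276
  (.leaf [1845690, 2645000, 2558340, 2548570, 1845830, 2635000, 1735680, 2335680, 2536570,
    2368030, 2245860, 2278300, 1768040, 2678000, 1867400, 2579680, 2667000])
  (.leaf [2235690, 2635000, 2558340, 2538570, 2235840, 2645000, 1945680, 2145680, 2546570,
    2168040, 1835860, 1878400, 1968030, 2678000, 2267300, 2579680, 2667000]))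
  (.leaf [1935640, 1935840, 1745630, 1745830, 2635000, 2645000, 2557340]))
  (.leaf [1734980, 2278340, 1878430, 1878930, 2678000, 1878010, 1878030, 2278040, 2301380, 310248,
    380134]))
  (.leaf [1734960, 2267340, 1867430, 1867930, 2667000, 1767010, 1867030, 2267040, 2301360, 310246,
    360134]))
  (.leaf [1778010, 1778310, 1778410, 1778910, 2678000]))
  (.leaf [1712760, 2167010, 2167310, 2167410, 2167910, 2667000]))
  (.split [] 502
  (.split [1912500, 2112500, 1912530, 2112530, 1912540, 2112540, 1901350, 1702450, 1350234,
    831259, 40159] 1470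
  (.split [2536570, 2537560, 2537680, 2635000, 2558340, 1935800, 1935840, 2135840, 1935890,
    1240358, 2334980] 2268
  (.leaf [2167350, 1735870, 2178030, 2178430, 2178930, 2678000])
  (.leaf [1767350, 2367350, 2345630, 2135870, 2645000, 1845780, 2547580, 2378040, 2378940,
    2678000]))
  (.split [] 1874
  (.split [2546580, 2548560, 2548670, 2645000, 2557340, 1745700, 1745730, 2245730, 1745790,
    1130457, 1734970] 2272
  (.leaf [1968450, 2168450, 2135640, 2345780, 2635000, 2235870, 2538570, 1778030, 1778930,
    2678000])
  (.leaf [2368450, 1945780, 1978040, 1978340, 1978940, 2678000]))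
  (.split [] 1870
  (.split [2546570, 2547560, 2547680, 2645000, 2558340, 1745800, 1745830, 2245830, 1745890,
    1130458, 1734980] 2268
  (.leaf [1967450, 2167450, 2135640, 2345870, 2635000, 2235780, 2537580, 2178030, 2178930,
    2678000])
  (.leaf [2367450, 1945870, 2378040, 2378340, 2378940, 2678000]))
  (.split [] 1474
  (.split [2536580, 2538560, 2538670, 2635000, 2557340, 1935700, 1935740, 2135740, 1935790,
    1240357, 2334970] 2272
  (.leaf [2168350, 1735780, 1778030, 1778430, 1778930, 2678000])
  (.leaf [1768350, 2368350, 2345630, 2135780, 2645000, 1845870, 2548570, 1978040, 1978940,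
    2678000]))
  (.split [] 1514
  (.split [2537580, 2538570, 2635000, 2556340, 1735610, 2235610, 1935640, 2135640, 1240356,
    342356, 2334960] 1830
  (.leaf [1745700, 1745710, 2245710, 1945720, 1745760, 2267040, 1867150, 1867240, 1967940,
    2667000])
  (.leaf [2645000, 1745800, 1745810, 2245810, 1945820, 1745860, 2268040, 1868150, 1868240,
    1968940, 2668000]))
  (.split [] 1914
  (.split [2547580, 2548570, 2645000, 2556340, 2145620, 1745630, 2245630, 1130456, 431456,
    1734960] 1430
  (.leaf [1935700, 1735710, 2135720, 1935760, 1867030, 2267130, 2267250, 1767930, 2667000])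
  (.leaf [2635000, 1935800, 1735810, 2135820, 1935860, 1868030, 2268130, 2268250, 1768930,
    2668000]))
  (.split [] 1426
  (.split [2556340, 1735610, 2235610, 1935640, 2135640, 1240356, 342356, 2334960] 1830
  (.leaf [1745700, 1745710, 2245710, 1945720, 1745760, 2267040, 1867150, 1867240, 1967940,
    2667000])
  (.leaf [2645000, 1745800, 1745810, 2245810, 1945820, 1745860, 2268040, 1868150, 1868240,
    1968940, 2668000]))
  (.split [] 628
  (.split [1712570] 148
  (.split [] 1430
  (.split [2557340, 1935740, 2135740, 1240357, 2334970] 1912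
  (.leaf [1978040, 1978940, 2678000])
  (.leaf [1745870, 2645000, 1745600, 1745610, 2245610, 1945620, 1745670, 2267040, 1867150,
    1767240, 2367940, 2667000]))
  (.leaf [2635000, 2558340, 1935800, 1735810, 2235810, 1935840, 2135840, 1240358, 1878030,
    2334980, 2678000, 2278940, 2589670, 1745790, 2645000, 1745600, 1745610, 2245610, 1945620,
    1745680, 2268040, 1868150, 1768240, 2668000]))
  (.leaf [1901370, 1935700, 310247, 2635000, 1745710, 2558340, 1935800, 2135800, 1935840, 2135840,
    2645000, 1240358, 342358, 1701380, 2334980, 1745600, 2245600, 1945620, 1745690, 2268040,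
    1504568, 1868240, 2368100, 2268940, 2668000]))
  (.leaf [2335710, 2345710, 2635000, 2558340, 1935800, 2135800, 1935840, 2135840, 2645000,
    1240358, 342358, 1701380, 2334980, 1745600, 2245600, 1945620, 1745690, 2268040, 1504568,
    1868240, 2368100, 2268940, 2668000])))))))))
  (.split [2612000, 2518260, 2528160, 1912800, 2112800, 1912830, 2112830, 1912840, 2112840,
    1912890, 1901380, 1702480, 1380234, 831289] 504
  (.split [1912860] 508
  (.split [1912870, 1867120, 2267210] 1384
  (.split [1934960, 2134960] 1388
  (.split [1934970, 1867340, 2267430, 2267930, 2667000, 2506780, 2507680] 1380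
  (.split [1735840, 1945830] 2276
  (.leaf [1845690, 2645000, 2557340, 2547580, 1845730, 2635000, 1735670, 2335670, 2536580,
    2367030, 2245760, 2278300, 1767040, 2678000, 1868400, 2589670, 2668000])
  (.leaf [2235690, 2635000, 2557340, 2537580, 2235740, 2645000, 1945670, 2145670, 2546580,
    2167040, 1835760, 1878400, 1967030, 2678000, 2268300, 2589670, 2668000]))
  (.leaf [1935640, 1935740, 1745630, 1745730, 2635000, 2645000, 2558340]))
  (.leaf [1734970, 2278340, 1878430, 1878930, 2678000, 1778010, 1878030, 2278040, 2301370, 310247,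
    370134]))
  (.leaf [1734960, 2268340, 1868430, 1868930, 2668000, 1768010, 1868030, 2268040, 2301360, 310246,
    360134]))
  (.leaf [1712870, 2178010, 2178310, 2178410, 2178910, 2678000]))
  (.leaf [1712860, 2168010, 2168310, 2168410, 2168910, 2668000])))))))))))))))

theorem rainbowCert_check : rainbowCert.check rainbowHyps 0 = true := by decide +kernel

theorem pairCert_check : pairCert.check pairHyps 0 = true := by decide +kernel

/-- The meaning of a literal for an orientation function `F`. -/
def Holds (F : ℕ → ℕ → ℕ → ℝ) (l : ℕ) : Prop :=
  if l % 4 = 0 then 0 < F (l / 4 / 100) (l / 4 / 10 % 10) (l / 4 % 10)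
  else if l % 4 = 1 then ¬ 0 < F (l / 4 / 100) (l / 4 / 10 % 10) (l / 4 % 10)
  else if l % 4 = 2 then F (l / 4 / 100) (l / 4 / 10 % 10) (l / 4 % 10) = 0
  else F (l / 4 / 100) (l / 4 / 10 % 10) (l / 4 % 10) ≠ 0

/-- The properties of the orientation function of a `{3,3,3,1}`-blocked set, where the points
`0, …, 9` have colours `0, 0, 0, 1, 1, 1, 2, 2, 2, 3`. -/
structure IsBlockedOrientation (F : ℕ → ℕ → ℕ → ℝ) : Prop where
  swap_left : ∀ a b c, F b a c = -F a b c
  swap_right : ∀ a b c, F a c b = -F a b c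
  grassmann : ∀ a b c d e, F a b c * F a d e - F a b d * F a c e + F a b e * F a c d = 0
  cross : ∀ a < 10, ∀ b < 10, ∀ c < 10, ∀ d < 10, [a, b, c, d].Nodup → F a b c = 0 → F a b d ≠ 0
  nondegenerate : ∀ a < 10, ∀ b < 10, ∀ c < 10, [a, b, c].Nodup → ¬ TwoOne a b c → F a b c ≠ 0
  side : ∀ a < 10, ∀ b < 10, ∀ c < 10, a ≠ b → a / 3 = b / 3 → c / 3 ≠ a / 3 → F a b c = 0 →
    ∃ t : ℝ, 0 < t ∧ t < 1 ∧ ∀ d, F a c d = t * F a b d ∧ F c b d = (1 - t) * F a b d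
  edge : ∀ a < 10, ∀ b < 10, a ≠ b → a / 3 = b / 3 → ∃ c < 10, c / 3 ≠ a / 3 ∧ F a b c = 0

section Soundness

variable {F : ℕ → ℕ → ℕ → ℝ}

theorem holds_four_mul (t : ℕ) : Holds F (4 * t) ↔ 0 < F (t / 100) (t / 10 % 10) (t % 10) := by
  simp [Holds]

theorem holds_four_mul_add_one (t : ℕ) :
    Holds F (4 * t + 1) ↔ ¬ 0 < F (t / 100) (t / 10 % 10) (t % 10) := by
  have h1 : (4 * t + 1) % 4 = 1 := by omega
  have h2 : (4 * t + 1) / 4 = t := by omega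
  simp [Holds, h1, h2]

theorem holds_four_mul_add_two (t : ℕ) :
    Holds F (4 * t + 2) ↔ F (t / 100) (t / 10 % 10) (t % 10) = 0 := by
  have h1 : (4 * t + 2) % 4 = 2 := by omega
  have h2 : (4 * t + 2) / 4 = t := by omega
  simp [Holds, h1, h2]

theorem holds_four_mul_add_three (t : ℕ) :
    Holds F (4 * t + 3) ↔ F (t / 100) (t / 10 % 10) (t % 10) ≠ 0 := by
  have h1 : (4 * t + 3) % 4 = 3 := by omega
  have h2 : (4 * t + 3) / 4 = t := by omega
  simp [Holds, h1, h2]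

theorem holds_negLit (l : ℕ) : Holds F (negLit l) ↔ ¬ Holds F l := by
  obtain ⟨t, r, hr, rfl⟩ : ∃ t r, r < 4 ∧ l = 4 * t + r :=
    ⟨l / 4, l % 4, Nat.mod_lt _ (by norm_num), by omega⟩
  interval_cases r
  · rw [show negLit (4 * t + 0) = 4 * t + 1 by unfold negLit; split_ifs <;> omega]
    rw [holds_four_mul_add_one, add_zero, holds_four_mul]
  · rw [show negLit (4 * t + 1) = 4 * t by unfold negLit; split_ifs <;> omega]
    rw [holds_four_mul_add_one, holds_four_mul, not_not]
  · rw [show negLit (4 * t + 2) = 4 * t + 3 by unfold negLit; split_ifs <;> omega]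
    rw [holds_four_mul_add_two, holds_four_mul_add_three]
  · rw [show negLit (4 * t + 3) = 4 * t + 2 by unfold negLit; split_ifs <;> omega]
    rw [holds_four_mul_add_two, holds_four_mul_add_three, not_not]

theorem holds_triple {a b c : ℕ} (hb : b < 10) (hc : c < 10) :
    F ((100 * a + 10 * b + c) / 100) ((100 * a + 10 * b + c) / 10 % 10)
      ((100 * a + 10 * b + c) % 10) = F a b c := by
  congr 1 <;> omega

namespace IsBlockedOrientation

variable (hF : IsBlockedOrientation F)
include hF

theorem holds_orientLit {a b c : ℕ} (ha : a < 10) (hb : b < 10) (hc : c < 10) (h : F a b c ≠ 0) :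
    Holds F (orientLit a b c) ↔ 0 < F a b c := by
  have h1 := hF.swap_left a b c
  have h2 := hF.swap_right a b c
  have h3 := hF.swap_left a c b
  have h4 := hF.swap_right b a c
  have h5 := hF.swap_left b c a
  unfold orientLit
  split_ifs <;> simp only [holds_four_mul, holds_four_mul_add_one, holds_triple, ha, hb, hc] <;>
    rcases lt_or_gt_of_ne h with h | h <;> constructor <;> intro <;> linarith

theorem orientLit_zero {a b c : ℕ} (ha : a < 10) (hb : b < 10) (hc : c < 10) :
    F (orientLit a b c / 4 / 100) (orientLit a b c / 4 / 10 % 10) (orientLit a b c / 4 % 10) = 0 ↔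
      F a b c = 0 := by
  have h1 := hF.swap_left a b c
  have h2 := hF.swap_right a b c
  have h3 := hF.swap_left a c b
  have h4 := hF.swap_right b a c
  have h5 := hF.swap_left b c a
  have e1 : ∀ t, (4 * t + 1) / 4 = t := fun t => by omega
  have e2 : ∀ t, (4 * t) / 4 = t := fun t => by omega
  unfold orientLit
  split_ifs <;> simp only [e1, e2, holds_triple, ha, hb, hc] <;>
    constructor <;> intro <;> linarith

theorem holds_collLit {a b c : ℕ} (ha : a < 10) (hb : b < 10) (hc : c < 10) :
    Holds F (collLit a b c) ↔ F a b c = 0 := by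
  rw [collLit, mul_comm, holds_four_mul_add_two, hF.orientLit_zero ha hb hc]

theorem holds_ncollLit {a b c : ℕ} (ha : a < 10) (hb : b < 10) (hc : c < 10) :
    Holds F (ncollLit a b c) ↔ F a b c ≠ 0 := by
  rw [ncollLit, mul_comm, holds_four_mul_add_three, Ne, hF.orientLit_zero ha hb hc]

theorem ne_zero_of_ncollLits {a b c : ℕ} (ha : a < 10) (hb : b < 10) (hc : c < 10)
    (hd : [a, b, c].Nodup) (h : ∀ l ∈ ncollLits a b c, Holds F l) : F a b c ≠ 0 := by
  by_cases ht : TwoOne a b c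
  · exact (hF.holds_ncollLit ha hb hc).1 (h _ (by simp [ncollLits, ht]))
  · exact hF.nondegenerate a ha b hb c hc hd ht

theorem sign_of_signLit {a b c : ℕ} (ha : a < 10) (hb : b < 10) (hc : c < 10) (h : F a b c ≠ 0)
    {s : Bool} (hs : Holds F (signLit s (orientLit a b c))) :
    0 < (bif s then 1 else -1) * F a b c := by
  cases s
  · simp only [signLit, Bool.false_eq_true, if_false, holds_negLit,
      hF.holds_orientLit ha hb hc h] at hs
    have := lt_of_le_of_ne (not_lt.1 hs) h
    simpa using this
  · simp only [signLit, if_true, hF.holds_orientLit ha hb hc h] at hs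
    simpa using hs

omit hF in
theorem not_holds_zero_one : ¬ ∀ l ∈ [0, 1], Holds F l := fun h =>
  (holds_negLit 0).1 (h 1 (by simp)) (h 0 (by simp))

theorem not_holds_gpNogood {v a b c d e : ℕ} (ha : a < 10) (hb : b < 10) (hc : c < 10)
    (hd : d < 10) (he : e < 10) : ¬ ∀ l ∈ gpNogood v a b c d e, Holds F l := by
  unfold gpNogood
  split_ifs with hn
  swap
  · exact not_holds_zero_one
  intro h
  simp only [List.forall_mem_append, List.forall_mem_cons] at h
  obtain ⟨⟨h1, h2, h3, h4, h5, h6, -⟩, ⟨⟨⟨⟨n1, n2⟩, n3⟩, n4⟩, n5⟩, n6⟩ := h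
  have g1 := hF.sign_of_signLit ha hb hc (hF.ne_zero_of_ncollLits ha hb hc (by grind) n1) h1
  have g2 := hF.sign_of_signLit ha hd he (hF.ne_zero_of_ncollLits ha hd he (by grind) n2) h2
  have g3 := hF.sign_of_signLit ha hb hd (hF.ne_zero_of_ncollLits ha hb hd (by grind) n3) h3
  have g4 := hF.sign_of_signLit ha hc he (hF.ne_zero_of_ncollLits ha hc he (by grind) n4) h4
  have g5 := hF.sign_of_signLit ha hb he (hF.ne_zero_of_ncollLits ha hb he (by grind) n5) h5
  have g6 := hF.sign_of_signLit ha hc hd (hF.ne_zero_of_ncollLits ha hc hd (by grind) n6) h6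
  have g := hF.grassmann a b c d e
  have k1 := mul_pos g1 g2
  have k2 := mul_pos g3 g4
  have k3 := mul_pos g5 g6
  generalize (v % 2 == 0) = m1 at *
  generalize (v / 2 % 2 == 0) = m2 at *
  generalize (v / 4 % 2 == 0) = m3 at *
  generalize (v / 8 == 0) = s at *
  cases s <;> cases m1 <;> cases m2 <;> cases m3 <;> simp at k1 k2 k3 <;> linarith

theorem not_holds_sideNogood {v a b c d : ℕ} (ha : a < 10) (hb : b < 10) (hc : c < 10)
    (hd : d < 10) : ¬ ∀ l ∈ sideNogood v a b c d, Holds F l := by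
  unfold sideNogood
  split_ifs with hn
  swap
  · exact not_holds_zero_one
  intro h
  simp only [List.forall_mem_cons, hF.holds_collLit ha hb hc, holds_negLit] at h
  obtain ⟨h0, h1, h2, -⟩ := h
  obtain ⟨hn, hab, hca⟩ := hn
  obtain ⟨t, t0, t1, ht⟩ := hF.side a ha b hb c hc (by grind) hab hca h0
  have hx := hF.cross a ha b hb c hc d hd hn h0
  obtain ⟨e1, e2⟩ := ht d
  have t2 : 0 < 1 - t := by linarith
  have key : ∀ n, Holds F (sideLit n a b c d) ↔ 0 < F a b d := by
    intro n
    unfold sideLit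
    split_ifs
    · rw [hF.holds_orientLit ha hc hd (by rw [e1]; positivity), e1, mul_pos_iff_of_pos_left t0]
    · exact hF.holds_orientLit ha hb hd hx
    · rw [hF.holds_orientLit hc hb hd (by rw [e2]; positivity), e2, mul_pos_iff_of_pos_left t2]
  exact h2 ((key _).2 ((key _).1 h1))

theorem not_holds_crossNogood {a b c d : ℕ} (ha : a < 10) (hb : b < 10) (hc : c < 10)
    (hd : d < 10) : ¬ ∀ l ∈ crossNogood a b c d, Holds F l := by
  unfold crossNogood
  split_ifs with hn
  swap
  · exact not_holds_zero_one
  intro h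
  simp only [List.forall_mem_cons, hF.holds_collLit ha hb hc, hF.holds_collLit ha hb hd] at h
  exact hF.cross a ha b hb c hc d hd hn h.1 h.2.1

theorem not_holds_edgeNogood {a b : ℕ} (ha : a < 10) (hb : b < 10) :
    ¬ ∀ l ∈ edgeNogood a b, Holds F l := by
  unfold edgeNogood
  split_ifs with hn
  swap
  · exact not_holds_zero_one
  intro h
  obtain ⟨c, hc, hca, h0⟩ := hF.edge a ha b hb hn.1 hn.2
  exact (hF.holds_ncollLit ha hb hc).1 (h _ (List.mem_map_of_mem (by simp [hc, hca]))) h0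

theorem not_holds_nogood {hyps : List (List ℕ)} (hh : ∀ L ∈ hyps, ¬ ∀ l ∈ L, Holds F l) (s : ℕ) :
    ¬ ∀ l ∈ nogood hyps s, Holds F l := by
  have hlt : ∀ n, n % 10 < 10 := fun n => Nat.mod_lt _ (by norm_num)
  unfold nogood
  dsimp only
  split_ifs
  · exact hF.not_holds_gpNogood (hlt _) (hlt _) (hlt _) (hlt _) (hlt _)
  · exact hF.not_holds_sideNogood (hlt _) (hlt _) (hlt _) (hlt _)
  · exact hF.not_holds_crossNogood (hlt _) (hlt _) (hlt _) (hlt _)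
  · exact hF.not_holds_edgeNogood (hlt _) (hlt _)
  · rw [List.getD_eq_getElem?_getD]
    rcases h : hyps[s / 100000 - 27]? with _ | L
    · exact not_holds_zero_one
    · exact hh L (List.mem_of_getElem? h)

omit hF in
theorem holds_mask_insert {M l : ℕ} (hM : ∀ n, M.testBit n → Holds F n) (hl : Holds F l) (n : ℕ)
    (hn : (M ||| 2 ^ l).testBit n) : Holds F n := by
  rw [Nat.testBit_or, Nat.testBit_two_pow, Bool.or_eq_true, decide_eq_true_eq] at hn
  rcases hn with hn | rfl
  exacts [hM n hn, hl]

theorem propagate_sound {hyps : List (List ℕ)} (hh : ∀ L ∈ hyps, ¬ ∀ l ∈ L, Holds F l)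
    {k : ℕ → Bool} (hk : ∀ M, k M = true → ¬ ∀ n, M.testBit n → Holds F n) (ss : List ℕ) :
    ∀ M, propagate hyps ss k M = true → ¬ ∀ n, M.testBit n → Holds F n := by
  induction ss with
  | nil => exact hk
  | cons s ss ih =>
    intro M h hM
    have hs := hF.not_holds_nogood hh s
    rw [propagate] at h
    split at h
    · next hf =>
      refine hs fun l hl => hM l ?_
      by_contra hb
      have : l ∈ (nogood hyps s).filter fun l => !M.testBit l := by
        simpa [hl] using hb
      rw [hf] at this
      simp at this
    · next l hf =>
      refine ih _ h (holds_mask_insert hM ((holds_negLit l).2 fun hl => hs fun n hn => ?_))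
      by_cases hb : M.testBit n
      · exact hM n hb
      have : n ∈ (nogood hyps s).filter fun l => !M.testBit l := by simp [hn, hb]
      rw [hf, List.mem_singleton] at this
      rwa [this]
    · simp at h

theorem check_sound {hyps : List (List ℕ)} (hh : ∀ L ∈ hyps, ¬ ∀ l ∈ L, Holds F l)
    (R : Refutation) : ∀ M, R.check hyps M = true → ¬ ∀ n, M.testBit n → Holds F n := by
  induction R with
  | leaf ss => exact hF.propagate_sound hh (by simp) ss
  | split ss l p n ihp ihn =>
    refine hF.propagate_sound hh (fun M h hM => ?_) ss
    rw [Bool.and_eq_true] at h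
    by_cases hl : Holds F l
    · exact ihp _ h.1 (holds_mask_insert hM hl)
    · exact ihn _ h.2 (holds_mask_insert hM ((holds_negLit l).2 hl))

theorem false_of_check {hyps : List (List ℕ)} (hh : ∀ L ∈ hyps, ¬ ∀ l ∈ L, Holds F l)
    {R : Refutation} (h : R.check hyps 0 = true) : False :=
  hF.check_sound hh R 0 h fun n hn => by simp at hn

end IsBlockedOrientation

end Soundness

/-- Twice the signed area of a triangle. -/
def orient (x y z : ℝ × ℝ) : ℝ := (y.1 - x.1) * (z.2 - x.2) - (y.2 - x.2) * (z.1 - x.1)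

theorem orient_swap_left (x y z : ℝ × ℝ) : orient y x z = -orient x y z := by
  unfold orient; ring

theorem orient_swap_right (x y z : ℝ × ℝ) : orient x z y = -orient x y z := by
  unfold orient; ring

theorem exists_lineMap_of_orient_eq_zero {x y z : ℝ × ℝ} (hxy : x ≠ y) (h : orient x y z = 0) :
    ∃ t : ℝ, AffineMap.lineMap x y t = z := by
  obtain ⟨x1, x2⟩ := x
  obtain ⟨y1, y2⟩ := y
  obtain ⟨z1, z2⟩ := z
  simp only [orient] at h
  by_cases h1 : y1 - x1 = 0
  · have h2 : y2 - x2 ≠ 0 := fun h2 => hxy (by ext <;> simp <;> linarith)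
    refine ⟨(z2 - x2) / (y2 - x2), ?_⟩
    have : z1 - x1 = 0 := by
      rw [h1, zero_mul, zero_sub, neg_eq_zero] at h
      exact (mul_eq_zero.1 h).resolve_left h2
    ext <;> simp [AffineMap.lineMap_apply]
    · rw [h1]; linarith
    · field_simp; ring
  · refine ⟨(z1 - x1) / (y1 - x1), ?_⟩
    ext <;> simp [AffineMap.lineMap_apply]
    · field_simp; ring
    · field_simp; linarith

theorem lineMap_mem_openSegment_lineMap (x y : ℝ × ℝ) {r s t : ℝ} (hr : r < s) (ht : s < t) :
    AffineMap.lineMap x y s ∈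
      openSegment ℝ (AffineMap.lineMap x y r : ℝ × ℝ) (AffineMap.lineMap x y t) := by
  rw [← image_openSegment ℝ (AffineMap.lineMap x y : ℝ →ᵃ[ℝ] ℝ × ℝ),
    openSegment_eq_Ioo (hr.trans ht)]
  exact Set.mem_image_of_mem _ ⟨hr, ht⟩

theorem orient_eq_zero_of_mem_openSegment {x y z : ℝ × ℝ} (h : z ∈ openSegment ℝ x y) :
    orient x y z = 0 := by
  rw [openSegment_eq_image_lineMap] at h
  obtain ⟨t, -, rfl⟩ := h
  simp [orient, AffineMap.lineMap_apply]; ring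

theorem mem_openSegment_of_orient_eq_zero {x y z : ℝ × ℝ} (hxy : x ≠ y) (hxz : x ≠ z)
    (hyz : y ≠ z) (h : orient x y z = 0) :
    z ∈ openSegment ℝ x y ∨ x ∈ openSegment ℝ z y ∨ y ∈ openSegment ℝ z x := by
  obtain ⟨t, rfl⟩ := exists_lineMap_of_orient_eq_zero hxy h
  have h0 : t ≠ 0 := by rintro rfl; simp at hxz
  have h1 : t ≠ 1 := by rintro rfl; simp at hyz
  have key := fun r s t : ℝ => @lineMap_mem_openSegment_lineMap x y r s t
  rcases lt_or_gt_of_ne h0 with h0 | h0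
  · exact .inr (.inl (by simpa using key t 0 1 h0 one_pos))
  rcases lt_or_gt_of_ne h1 with h1 | h1
  · exact .inl (by simpa using key 0 t 1 h0 h1)
  · exact .inr (.inr (by simpa [openSegment_symm] using key 0 1 t one_pos h1))

/-- Labels for the points of a `{3,3,3,1}`-blocked set: three classes of three points, and a
single point. -/
abbrev Label := Option (Fin 3 × Fin 3)

/-- The colour of a label. -/
def colour (k : Label) : Option (Fin 3) := k.map Prod.fst

@[simp] theorem colour_some (x : Fin 3 × Fin 3) : colour (some x) = some x.1 := rfl

@[simp] theorem colour_none : colour none = none := rfl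

/-- A labelled `{3,3,3,1}`-blocked point set. -/
structure IsBlockedLabelling (p : Label → ℝ × ℝ) : Prop where
  injective : Function.Injective p
  blocked_iff : ∀ k l, k ≠ l → ((∃ m, p m ∈ openSegment ℝ (p k) (p l)) ↔ colour k = colour l)

theorem not_injective_of_colour_eq {i : Fin 4 → Label} (hi : Function.Injective i)
    (h : ∀ r, colour (i r) = colour (i 0)) : False := by
  rcases h0 : i 0 with _ | x
  · have := h 1
    rw [h0] at this
    rcases h1 : i 1 with _ | y
    · exact absurd (hi (h0.trans h1.symm)) (by decide)
    · rw [h1] at this; simp at this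
  · have : ∀ r, ∃ j : Fin 3, i r = some (x.1, j) := by
      intro r
      have hr := h r
      rw [h0] at hr
      rcases h1 : i r with _ | y
      · rw [h1] at hr; simp at hr
      · rw [h1] at hr
        simp only [colour_some, Option.some.injEq] at hr
        exact ⟨y.2, by rw [← hr]⟩
    choose j hj using this
    have hj' : Function.Injective j := fun r s hrs => hi (by rw [hj, hj, hrs])
    simpa using Fintype.card_le_of_injective j hj'

namespace IsBlockedLabelling

variable {p : Label → ℝ × ℝ} (hp : IsBlockedLabelling p)
include hp

theorem relabel (e : Equiv.Perm Label)
    (he : ∀ k l, colour (e k) = colour (e l) ↔ colour k = colour l) :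
    IsBlockedLabelling (p ∘ e) where
  injective := hp.injective.comp e.injective
  blocked_iff k l hkl := by
    rw [← he, ← hp.blocked_iff _ _ (e.injective.ne hkl)]
    exact (e.surjective.exists (p := fun m => p m ∈ openSegment ℝ (p (e k)) (p (e l)))).symm

theorem not_four_collinear {k l m n : Label} (hn : [k, l, m, n].Nodup)
    (hm : orient (p k) (p l) (p m) = 0) (hn' : orient (p k) (p l) (p n) = 0) : False := by
  have hkl : p k ≠ p l := hp.injective.ne (by grind)
  have hex : ∀ i ∈ ({k, l, m, n} : Finset Label),
      ∃ t : ℝ, AffineMap.lineMap (p k) (p l) t = p i := by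
    intro i hi
    simp only [Finset.mem_insert, Finset.mem_singleton] at hi
    rcases hi with rfl | rfl | rfl | rfl
    · exact ⟨0, by simp⟩
    · exact ⟨1, by simp⟩
    · exact exists_lineMap_of_orient_eq_zero hkl hm
    · exact exists_lineMap_of_orient_eq_zero hkl hn'
  choose! f hf using hex
  have hinj : Set.InjOn f ({k, l, m, n} : Finset Label) := fun i hi j hj hij =>
    hp.injective (by rw [← hf i hi, ← hf j hj, hij])
  have hcard : (({k, l, m, n} : Finset Label).image f).card = 4 := by
    rw [Finset.card_image_of_injOn hinj]
    simpa using List.toFinset_card_of_nodup hn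
  have hg := fun r => Finset.mem_image.1 (Finset.orderEmbOfFin_mem _ hcard r)
  choose i hi hfi using hg
  have hlt : ∀ r s, r < s → f (i r) < f (i s) := fun r s h => by
    rw [hfi, hfi]; exact (Finset.orderEmbOfFin _ hcard).strictMono h
  have hii : Function.Injective i := fun r s hrs =>
    (Finset.orderEmbOfFin _ hcard).injective (by rw [← hfi, ← hfi, hrs])
  have hcol : ∀ r s t, r < s → s < t → colour (i r) = colour (i t) := fun r s t hrs hst => by
    refine (hp.blocked_iff _ _ (hii.ne (hrs.trans hst).ne)).1 ⟨i s, ?_⟩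
    rw [← hf _ (hi r), ← hf _ (hi s), ← hf _ (hi t)]
    exact lineMap_mem_openSegment_lineMap _ _ (hlt _ _ hrs) (hlt _ _ hst)
  have h02 := hcol 0 1 2 (by decide) (by decide)
  have h03 := hcol 0 1 3 (by decide) (by decide)
  have h13 := hcol 1 2 3 (by decide) (by decide)
  refine not_injective_of_colour_eq hii fun r => ?_
  fin_cases r
  exacts [rfl, h13.trans h03.symm, h02.symm, h03.symm]

theorem ne_of_mem_openSegment {k l m : Label} (hkl : k ≠ l)
    (h : p m ∈ openSegment ℝ (p k) (p l)) : m ≠ k ∧ m ≠ l := by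
  have hne := hp.injective.ne hkl
  constructor
  · rintro rfl
    exact hne (left_mem_openSegment_iff.1 h)
  · rintro rfl
    exact hne (right_mem_openSegment_iff.1 h)

theorem colour_ne_of_mem_openSegment {k l m : Label} (hkl : k ≠ l)
    (h : p m ∈ openSegment ℝ (p k) (p l)) : colour m ≠ colour k := by
  intro hc
  obtain ⟨hmk, hml⟩ := hp.ne_of_mem_openSegment hkl h
  obtain ⟨n, hn⟩ := (hp.blocked_iff k m hmk.symm).2 hc.symm
  obtain ⟨hnk, hnm⟩ := hp.ne_of_mem_openSegment hmk.symm hn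
  have hnl : n ≠ l := by
    rintro rfl
    rw [openSegment_eq_image_lineMap] at h hn
    obtain ⟨s, ⟨s0, s1⟩, hs⟩ := h
    obtain ⟨t, ⟨t0, t1⟩, ht⟩ := hn
    have hts : (AffineMap.lineMap (p k) (p n) (t * s) : ℝ × ℝ) =
        AffineMap.lineMap (p k) (p n) (1 : ℝ) := by
      rw [← AffineMap.lineMap_lineMap_right, hs, ht, AffineMap.lineMap_apply_one]
    have := AffineMap.lineMap_injective ℝ (hp.injective.ne hkl) hts
    nlinarith
  have h1 := orient_eq_zero_of_mem_openSegment hn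
  have h2 := orient_eq_zero_of_mem_openSegment h
  rw [orient_swap_right, neg_eq_zero] at h2
  exact hp.not_four_collinear (by grind) h1 h2

theorem blocks_of_orient_eq_zero {k l m : Label} (hkl : k ≠ l) (hc : colour k = colour l)
    (hm : colour m ≠ colour k) (h : orient (p k) (p l) (p m) = 0) :
    p m ∈ openSegment ℝ (p k) (p l) := by
  have hkm : k ≠ m := by rintro rfl; exact hm rfl
  have hlm : l ≠ m := by rintro rfl; exact hm hc.symm
  have hi := hp.injective
  rcases mem_openSegment_of_orient_eq_zero (hi.ne hkl) (hi.ne hkm) (hi.ne hlm) h with h | h | h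
  · exact h
  · exact absurd ((hp.blocked_iff _ _ hlm.symm).1 ⟨_, h⟩) (hc ▸ hm)
  · exact absurd ((hp.blocked_iff _ _ hkm.symm).1 ⟨_, h⟩) hm

theorem colour_of_orient_eq_zero {k l m : Label} (hkl : k ≠ l) (hkm : k ≠ m) (hlm : l ≠ m)
    (h : orient (p k) (p l) (p m) = 0) :
    colour k = colour l ∧ colour m ≠ colour k ∨ colour k = colour m ∧ colour l ≠ colour k ∨
      colour l = colour m ∧ colour k ≠ colour l := by
  have hi := hp.injective
  rcases mem_openSegment_of_orient_eq_zero (hi.ne hkl) (hi.ne hkm) (hi.ne hlm) h with h | h | h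
  · exact .inl ⟨(hp.blocked_iff _ _ hkl).1 ⟨_, h⟩, hp.colour_ne_of_mem_openSegment hkl h⟩
  · have hc := (hp.blocked_iff _ _ hlm.symm).1 ⟨_, h⟩
    exact .inr (.inr ⟨hc.symm, hc ▸ hp.colour_ne_of_mem_openSegment hlm.symm h⟩)
  · have hc := (hp.blocked_iff _ _ hkm.symm).1 ⟨_, h⟩
    exact .inr (.inl ⟨hc.symm, hc ▸ hp.colour_ne_of_mem_openSegment hkm.symm h⟩)

theorem exists_blocker {k l : Label} (hkl : k ≠ l) (hc : colour k = colour l) :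
    ∃ m, colour m ≠ colour k ∧ orient (p k) (p l) (p m) = 0 := by
  obtain ⟨m, hm⟩ := (hp.blocked_iff k l hkl).2 hc
  exact ⟨m, hp.colour_ne_of_mem_openSegment hkl hm, orient_eq_zero_of_mem_openSegment hm⟩

end IsBlockedLabelling

/-- The label of the point with number `n < 10`. -/
def label (n : ℕ) : Label := if n < 9 then some (Fin.ofNat 3 (n / 3), Fin.ofNat 3 (n % 3)) else none

theorem label_ne : ∀ a < 10, ∀ b < 10, a ≠ b → label a ≠ label b := by decide

theorem colour_label : ∀ a < 10, ∀ b < 10,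
    (colour (label a) = colour (label b) ↔ a / 3 = b / 3) := by
  decide

theorem exists_label : ∀ k : Label, ∃ n < 10, label n = k := by decide

/-- The orientations of the numbered points, normalised so that `0 1 2` is positive. -/
def orientation (p : Label → ℝ × ℝ) (a b c : ℕ) : ℝ :=
  orient (p (label 0)) (p (label 1)) (p (label 2)) *
    orient (p (label a)) (p (label b)) (p (label c))

namespace IsBlockedLabelling

variable {p : Label → ℝ × ℝ} (hp : IsBlockedLabelling p)
include hp

theorem orient_base_ne_zero : orient (p (label 0)) (p (label 1)) (p (label 2)) ≠ 0 := fun h => by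
  have := hp.colour_of_orient_eq_zero (by decide) (by decide) (by decide) h
  revert this
  decide

theorem orientation_eq_zero {a b c : ℕ} :
    orientation p a b c = 0 ↔ orient (p (label a)) (p (label b)) (p (label c)) = 0 := by
  simp [orientation, hp.orient_base_ne_zero]

theorem isBlockedOrientation : IsBlockedOrientation (orientation p) where
  swap_left a b c := by
    rw [orientation, orientation, orient_swap_left (p (label a)), mul_neg]
  swap_right a b c := by
    rw [orientation, orientation, orient_swap_right (p (label a)), mul_neg]
  grassmann a b c d e := by
    simp only [orientation, orient]; ring
  cross a ha b hb c hc d hd hn h h' := by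
    rw [hp.orientation_eq_zero] at h h'
    have := label_ne
    exact hp.not_four_collinear (by grind) h h'
  nondegenerate a ha b hb c hc hn ht h := by
    rw [hp.orientation_eq_zero] at h
    have := label_ne
    have := hp.colour_of_orient_eq_zero (by grind) (by grind) (by grind) h
    simp only [Ne, colour_label, ha, hb, hc] at this
    exact ht this
  side a ha b hb c hc hn hab hca h := by
    rw [hp.orientation_eq_zero] at h
    have h := hp.blocks_of_orient_eq_zero (label_ne a ha b hb hn) ((colour_label a ha b hb).2 hab)
      (mt (colour_label c hc a ha).1 hca) h
    rw [openSegment_eq_image_lineMap] at h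
    obtain ⟨t, ⟨t0, t1⟩, ht⟩ := h
    refine ⟨t, t0, t1, fun d => ?_⟩
    simp only [orientation, ← ht]
    simp only [orient, AffineMap.lineMap_apply, vsub_eq_sub, vadd_eq_add, Prod.fst_add,
      Prod.snd_add, Prod.smul_fst, Prod.smul_snd, Prod.fst_sub, Prod.snd_sub, smul_eq_mul]
    constructor <;> ring
  edge a ha b hb hn hab := by
    obtain ⟨m, hm, h⟩ := hp.exists_blocker (label_ne a ha b hb hn) ((colour_label a ha b hb).2 hab)
    obtain ⟨c, hc, rfl⟩ := exists_label m
    exact ⟨c, hc, mt (colour_label c hc a ha).2 hm, hp.orientation_eq_zero.2 h⟩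

end IsBlockedLabelling

/-- The relabelling permuting the colours by `σ` and the points of each class by `τ`. -/
def relabelling (σ : Equiv.Perm (Fin 3)) (τ : Fin 3 → Equiv.Perm (Fin 3)) : Equiv.Perm Label :=
  Equiv.optionCongr (σ.prodShear τ)

theorem relabelling_some (σ : Equiv.Perm (Fin 3)) (τ : Fin 3 → Equiv.Perm (Fin 3)) (x i : Fin 3) :
    relabelling σ τ (some (x, i)) = some (σ x, τ x i) := rfl

theorem relabelling_none (σ : Equiv.Perm (Fin 3)) (τ : Fin 3 → Equiv.Perm (Fin 3)) :
    relabelling σ τ none = none := rfl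

theorem colour_relabelling (σ : Equiv.Perm (Fin 3)) (τ : Fin 3 → Equiv.Perm (Fin 3)) (k l : Label) :
    colour (relabelling σ τ k) = colour (relabelling σ τ l) ↔ colour k = colour l := by
  rcases k with _ | ⟨x, i⟩ <;> rcases l with _ | ⟨y, j⟩ <;>
    simp [relabelling_some, relabelling_none]

theorem label_three_mul_add : ∀ y i : Fin 3, label (3 * y + i) = some (y, i) := by
  decide

theorem exists_ne_and_ne : ∀ i j : Fin 3, ∃ k : Fin 3, k ≠ i ∧ k ≠ j := by
  decide

theorem exists_perm_of_ne : ∀ i j : Fin 3, i ≠ j → ∃ τ : Equiv.Perm (Fin 3), τ 0 = i ∧ τ 1 = j := by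
  decide

theorem exists_perm_of_pairwise_ne : ∀ i j l : Fin 3, i ≠ j → i ≠ l → j ≠ l →
    ∃ τ : Equiv.Perm (Fin 3), τ 0 = i ∧ τ 1 = j ∧ τ 2 = l := by
  decide

theorem exists_perm_of_rainbow : ∀ (x : Fin 3) (c : Fin 3 → Option (Fin 3)),
    Function.Injective c → (∀ i, c i ≠ some x) →
    ∃ τ : Equiv.Perm (Fin 3), c (τ 2) = some (x + 1) ∧ c (τ 1) = some (x + 2) ∧ c (τ 0) = none := by
  decide +kernel

namespace IsBlockedLabelling

variable {p : Label → ℝ × ℝ} (hp : IsBlockedLabelling p)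
include hp

theorem holds_orientLit_base : Holds (orientation p) (orientLit 0 1 2) := by
  have h := hp.orient_base_ne_zero
  have hpos : 0 < orientation p 0 1 2 := mul_self_pos.2 h
  exact (hp.isBlockedOrientation.holds_orientLit (by norm_num) (by norm_num) (by norm_num)
    hpos.ne').2 hpos

theorem holds_ncollLit_iff {a b c : ℕ} (ha : a < 10) (hb : b < 10) (hc : c < 10) :
    Holds (orientation p) (ncollLit a b c) ↔
      orient (p (label a)) (p (label b)) (p (label c)) ≠ 0 := by
  rw [hp.isBlockedOrientation.holds_ncollLit ha hb hc, Ne, hp.orientation_eq_zero]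

theorem not_forall_holds_map_ncollLit {a b : ℕ} {L : List ℕ} (ha : a < 10) (hb : b < 10)
    (h : ∃ c ∈ L, c < 10 ∧ orient (p (label a)) (p (label b)) (p (label c)) = 0) :
    ¬ ∀ l ∈ L.map (ncollLit a b), Holds (orientation p) l := by
  obtain ⟨c, hcL, hc, h⟩ := h
  exact fun hL => (hp.holds_ncollLit_iff ha hb hc).1 (hL _ (List.mem_map_of_mem hcL)) h

theorem false_of_pair (h1 : orient (p (label 0)) (p (label 1)) (p (label 3)) = 0)
    (h2 : orient (p (label 0)) (p (label 2)) (p (label 4)) = 0)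
    (h3 : ∃ c ∈ [0, 1, 2, 6, 9], c < 10 ∧
      orient (p (label 3)) (p (label 4)) (p (label c)) = 0) : False := by
  refine hp.isBlockedOrientation.false_of_check (fun L hL => ?_) pairCert_check
  simp only [pairHyps, List.mem_cons, List.not_mem_nil, or_false] at hL
  rcases hL with rfl | rfl | rfl | rfl
  · simpa [holds_negLit] using hp.holds_orientLit_base
  · simpa [hp.holds_ncollLit_iff] using h1
  · simpa [hp.holds_ncollLit_iff] using h2
  · exact hp.not_forall_holds_map_ncollLit (by norm_num) (by norm_num) h3

theorem false_of_rainbow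
    (h : ∀ x : Fin 3, orient (p (some (x, 1))) (p (some (x, 2))) (p none) = 0)
    (h1 : ∀ x : Fin 3, ∃ i : Fin 3,
      orient (p (some (x, 0))) (p (some (x, 1))) (p (some (x + 1, i))) = 0)
    (h2 : ∀ x : Fin 3, ∃ i : Fin 3,
      orient (p (some (x, 0))) (p (some (x, 2))) (p (some (x + 2, i))) = 0) : False := by
  have key : ∀ a < 10, ∀ b < 10, ∀ n < 3, ∀ y : Fin 3, y.1 = n →
      (∃ i : Fin 3, orient (p (label a)) (p (label b)) (p (some (y, i))) = 0) →
      ¬ ∀ l ∈ [3 * n, 3 * n + 1, 3 * n + 2].map (ncollLit a b), Holds (orientation p) l := by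
    rintro a ha b hb n hn y rfl ⟨i, hi⟩
    refine hp.not_forall_holds_map_ncollLit ha hb ⟨3 * y + i, ?_, by omega, ?_⟩
    · fin_cases i <;> simp
    · rwa [label_three_mul_add]
  refine hp.isBlockedOrientation.false_of_check (fun L hL => ?_) rainbowCert_check
  simp only [rainbowHyps, List.mem_cons, List.not_mem_nil, or_false] at hL
  rcases hL with rfl | rfl | rfl | rfl | rfl | rfl | rfl | rfl | rfl | rfl
  · simpa [holds_negLit] using hp.holds_orientLit_base
  · exact hp.not_forall_holds_map_ncollLit (a := 1) (b := 2) (L := [9]) (by norm_num)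
      (by norm_num) ⟨9, by simp, by norm_num, h 0⟩
  · exact hp.not_forall_holds_map_ncollLit (a := 4) (b := 5) (L := [9]) (by norm_num)
      (by norm_num) ⟨9, by simp, by norm_num, h 1⟩
  · exact hp.not_forall_holds_map_ncollLit (a := 7) (b := 8) (L := [9]) (by norm_num)
      (by norm_num) ⟨9, by simp, by norm_num, h 2⟩
  · exact key 0 (by norm_num) 1 (by norm_num) 1 (by norm_num) _ rfl (h1 0)
  · exact key 0 (by norm_num) 2 (by norm_num) 2 (by norm_num) _ rfl (h2 0)
  · exact key 3 (by norm_num) 4 (by norm_num) 2 (by norm_num) _ rfl (h1 1)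
  · exact key 3 (by norm_num) 5 (by norm_num) 0 (by norm_num) _ rfl (h2 1)
  · exact key 6 (by norm_num) 7 (by norm_num) 0 (by norm_num) _ rfl (h1 2)
  · exact key 6 (by norm_num) 8 (by norm_num) 1 (by norm_num) _ rfl (h2 2)

theorem colour_blocker_ne {k a b u v : Label} (hka : k ≠ a) (hkb : k ≠ b) (hab : a ≠ b)
    (ha : colour a = colour k) (hb : colour b = colour k) (hu : colour u ≠ colour k)
    (hu' : orient (p k) (p a) (p u) = 0) (hv' : orient (p k) (p b) (p v) = 0) :
    colour u ≠ colour v := by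
  intro huv
  have hne : u ≠ v := by
    rintro rfl
    rw [orient_swap_right, neg_eq_zero] at hu' hv'
    exact hp.not_four_collinear (by grind) hu' hv'
  obtain ⟨w, hw, hw'⟩ := hp.exists_blocker hne huv
  rcases u with _ | ⟨y, r⟩
  · rcases v with _ | ⟨y, s⟩
    · exact hne rfl
    · simp at huv
  rcases v with _ | ⟨y', s⟩
  · simp at huv
  obtain rfl : y = y' := by simpa using huv
  rcases k with _ | ⟨x, i⟩
  · rcases a with _ | ⟨x, i⟩
    · exact hka rfl
    · simp at ha
  rcases a with _ | ⟨x', j⟩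
  · simp at ha
  obtain rfl : x' = x := by simpa using ha
  rcases b with _ | ⟨x, l⟩
  · simp at hb
  obtain rfl : x = x' := by simpa using hb
  obtain ⟨σ, rfl, rfl⟩ := exists_perm_of_ne x y (by rintro rfl; exact hu rfl)
  obtain ⟨τ₀, rfl, rfl, rfl⟩ := exists_perm_of_pairwise_ne i j l (by rintro rfl; exact hka rfl)
    (by rintro rfl; exact hkb rfl) (by rintro rfl; exact hab rfl)
  obtain ⟨τ₁, rfl, rfl⟩ := exists_perm_of_ne r s (by rintro rfl; exact hne rfl)
  have hrel := fun τ₂ => hp.relabel _ (colour_relabelling σ ![τ₀, τ₁, τ₂])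
  rcases w with _ | ⟨z, t⟩
  · exact (hrel 1).false_of_pair hu' hv' ⟨9, by simp, by norm_num, hw'⟩
  obtain ⟨c, rfl⟩ := σ.surjective z
  fin_cases c
  · obtain ⟨q, rfl⟩ := τ₀.surjective t
    fin_cases q
    · exact (hrel 1).false_of_pair hu' hv' ⟨0, by simp, by norm_num, hw'⟩
    · exact (hrel 1).false_of_pair hu' hv' ⟨1, by simp, by norm_num, hw'⟩
    · exact (hrel 1).false_of_pair hu' hv' ⟨2, by simp, by norm_num, hw'⟩
  · exact hw rfl
  · refine (hrel (Equiv.swap 0 t)).false_of_pair hu' hv' ⟨6, by simp, by norm_num, ?_⟩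
    have : relabelling σ ![τ₀, τ₁, Equiv.swap 0 t] (label 6) = some (σ 2, t) := by
      rw [show label 6 = some (2, 0) by decide, relabelling_some]
      simp
    rw [Function.comp_apply, Function.comp_apply, Function.comp_apply, this]
    exact hw'

theorem exists_rainbow_perm (x : Fin 3) : ∃ (τ : Equiv.Perm (Fin 3)) (u : Fin 3 → Label),
    colour (u 0) = none ∧ colour (u 1) = some (x + 2) ∧ colour (u 2) = some (x + 1) ∧
    orient (p (some (x, τ 1))) (p (some (x, τ 2))) (p (u 0)) = 0 ∧
    orient (p (some (x, τ 0))) (p (some (x, τ 2))) (p (u 1)) = 0 ∧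
    orient (p (some (x, τ 0))) (p (some (x, τ 1))) (p (u 2)) = 0 := by
  have hex : ∀ l : Fin 3, ∃ m : Label, colour m ≠ some x ∧
      orient (p (some (x, l + 1))) (p (some (x, l + 2))) (p m) = 0 := fun l =>
    hp.exists_blocker (k := some (x, l + 1)) (l := some (x, l + 2)) (by simp) rfl
  choose u hux hu using hex
  have hu' : ∀ i j l : Fin 3, i ≠ j → i ≠ l → j ≠ l →
      orient (p (some (x, i))) (p (some (x, j))) (p (u l)) = 0 := by
    intro i j l hij hil hjl
    have : i = l + 1 ∧ j = l + 2 ∨ i = l + 2 ∧ j = l + 1 := by omega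
    rcases this with ⟨rfl, rfl⟩ | ⟨rfl, rfl⟩
    · exact hu l
    · rw [orient_swap_left, hu l, neg_zero]
  have hinj : Function.Injective fun l => colour (u l) := by
    intro i j hij
    by_contra hne
    obtain ⟨k, hki, hkj⟩ : ∃ k : Fin 3, k ≠ i ∧ k ≠ j := exists_ne_and_ne i j
    exact hp.colour_blocker_ne (k := some (x, k)) (a := some (x, j)) (b := some (x, i))
      (by simpa) (by simpa) (by simpa using Ne.symm hne) rfl rfl (hux i)
      (hu' _ _ _ hkj hki (Ne.symm hne)) (hu' _ _ _ hki hkj hne) hij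
  obtain ⟨τ, t2, t1, t0⟩ := exists_perm_of_rainbow x _ hinj hux
  have ht := fun i j => τ.injective.ne_iff (x := i) (y := j)
  exact ⟨τ, u ∘ τ, t0, t1, t2, hu' _ _ _ (by simp) (by simp) (by simp),
    hu' _ _ _ (by simp) (by simp) (by simp), hu' _ _ _ (by simp) (by simp) (by simp)⟩

theorem false : False := by
  choose τ u h0 h1 h2 e0 e1 e2 using hp.exists_rainbow_perm
  have hex : ∀ (x : Fin 3) (k : Label), colour k = some x →
      ∃ i, relabelling 1 τ (some (x, i)) = k := by
    intro x k hk
    rcases k with _ | ⟨y, j⟩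
    · simp at hk
    · obtain rfl : y = x := by simpa using hk
      exact ⟨(τ y).symm j, by simp [relabelling_some]⟩
  refine (hp.relabel _ (colour_relabelling 1 τ)).false_of_rainbow (fun x => ?_) (fun x => ?_)
    fun x => ?_
  · have : u x 0 = none := by
      have := h0 x
      rcases h : u x 0 with _ | y
      · rfl
      · rw [h] at this; simp at this
    have := this ▸ e0 x
    exact this
  · obtain ⟨i, hi⟩ := hex _ _ (h2 x)
    exact ⟨i, by have := e2 x; rw [← hi] at this; exact this⟩
  · obtain ⟨i, hi⟩ := hex _ _ (h1 x)
    exact ⟨i, by have := e1 x; rw [← hi] at this; exact this⟩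

end IsBlockedLabelling

theorem exists_equiv_of_map_eq {k : ℕ} {f : Fin k → ℕ}
    (h : ({3, 3, 3, 1} : Multiset ℕ) = Finset.univ.val.map f) :
    ∃ g : Option (Fin 3) ≃ Fin k, (∀ x, f (g (some x)) = 3) ∧ f (g none) = 1 := by
  obtain rfl : k = 4 := by simpa using (congrArg Multiset.card h).symm
  have hcount : (Finset.univ.filter fun i => 1 = f i).card = 1 := by
    have := congrArg (Multiset.count 1) h
    rw [Multiset.count_map] at this
    exact this.symm.trans (by decide)
  obtain ⟨i, hi⟩ := Finset.card_eq_one.1 hcount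
  have hi' : ∀ j, 1 = f j ↔ j = i := fun j => by
    simpa using Finset.ext_iff.1 hi j
  have hf : ∀ j, f j = 3 ∨ f j = 1 := fun j => by
    have : f j ∈ ({3, 3, 3, 1} : Multiset ℕ) := h ▸ Multiset.mem_map_of_mem f (by simp)
    simpa using this
  refine ⟨(finSuccEquiv' i).symm, fun x => ?_, ?_⟩
  · refine (hf _).resolve_right fun hx => ?_
    have := (hi' _).1 hx.symm
    simp at this
  · simpa using ((hi' i).2 rfl).symm

theorem exists_isBlockedLabelling {P : Set (ℝ × ℝ)} (hP : IsNBlocked {3, 3, 3, 1} P) :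
    ∃ p, IsBlockedLabelling p := by
  obtain ⟨-, k, c, hc, hN⟩ := hP
  obtain ⟨g, hg3, hg1⟩ := exists_equiv_of_map_eq hN
  have h3 : ∀ x, ∃ f : Fin 3 → ℝ × ℝ, Function.Injective f ∧
      Set.range f = P ∩ c ⁻¹' {g (some x)} := by
    intro x
    obtain ⟨a, b, d, hab, had, hbd, h⟩ := Set.ncard_eq_three.1 (hg3 x)
    refine ⟨![a, b, d], ?_, ?_⟩
    · intro i j
      fin_cases i <;> fin_cases j <;> simp [hab, had, hbd, hab.symm, had.symm, hbd.symm]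
    · rw [h]; ext; simp [eq_comm]; tauto
  choose f hf hfr using h3
  obtain ⟨d, hd⟩ := Set.ncard_eq_one.1 hg1
  let p : Label → ℝ × ℝ := fun k => k.elim d fun x => f x.1 x.2
  have hmem : ∀ l, p l ∈ P ∧ c (p l) = g (colour l) := by
    rintro (_ | ⟨x, i⟩)
    · have : d ∈ P ∩ c ⁻¹' {g none} := hd ▸ rfl
      exact this
    · have : f x i ∈ P ∩ c ⁻¹' {g (some x)} := hfr x ▸ Set.mem_range_self i
      exact this
  have hsurj : ∀ y ∈ P, ∃ l, p l = y := by
    intro y hy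
    obtain ⟨x, hx⟩ := g.surjective (c y)
    rcases x with _ | x
    · have : y ∈ P ∩ c ⁻¹' {g none} := ⟨hy, hx.symm⟩
      rw [hd] at this
      exact ⟨none, this.symm⟩
    · have : y ∈ P ∩ c ⁻¹' {g (some x)} := ⟨hy, hx.symm⟩
      rw [← hfr] at this
      obtain ⟨i, hi⟩ := this
      exact ⟨some (x, i), hi⟩
  have hinj : Function.Injective p := by
    intro k l hkl
    have hcol : colour k = colour l := g.injective (by rw [← (hmem k).2, ← (hmem l).2, hkl])
    rcases k with _ | ⟨x, i⟩ <;> rcases l with _ | ⟨y, j⟩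
    · rfl
    · simp at hcol
    · simp at hcol
    · obtain rfl : x = y := by simpa using hcol
      rw [show i = j from hf x hkl]
  refine ⟨p, hinj, fun k l hkl => ?_⟩
  have := hc _ (hmem k).1 _ (hmem l).1 (hinj.ne hkl)
  rw [(hmem k).2, (hmem l).2, g.injective.ne_iff] at this
  rw [← not_iff_not]
  refine Iff.trans ?_ this
  constructor
  · intro h x hx hb
    obtain ⟨m, rfl⟩ := hsurj x hx
    exact h ⟨m, hb⟩
  · rintro h ⟨m, hm⟩
    exact h _ (hmem m).1 hm

/-- The 4-set `{3,3,3,1}` is not representable. -/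
theorem not_representable_3331 : ¬ Representable ({3, 3, 3, 1} : Multiset ℕ) := by
  rintro ⟨P, hP⟩
  obtain ⟨p, hp⟩ := exists_isBlockedLabelling hP
  exact hp.false
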